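/- Let a = (a_1,…,a_{2k}) be a sequence of positive integers with k ≥ 2, and define Φ_{x,y,z}(a) = φ_{x,y,z}(O(a),E(a)) · f_{x,y,z}(a). For all integers y, z ≥ 0, the value at x = 0 factors as Φ_{0,y,z}(a) = Q(0,a_1,…,a_{2k},y) · Q(a_1,…,a_{2k-1},a_{2k}+z). -/

import Mathlib

open Finset Nat

/-- Pochhammer symbol `(q)_n` for real `q` and integer `n`. -/
noncomputable def poch (q : ℝ) (n : ℤ) : ℝ :=
  if 0 ≤ n then ∏ i ∈ Finset.range n.toNat, (q + i)
  else 1 / ∏ i ∈ Finset.range (-n).toNat, (q - (i + 1))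

/-- Skipping Pochhammer symbol `[q]_n`. -/
noncomputable def spoch (q : ℝ) (n : ℤ) : ℝ :=
  if 0 ≤ n then ∏ i ∈ Finset.range n.toNat, (q + 2 * i)
  else 1 / ∏ i ∈ Finset.range (-n).toNat, (q - 2 * (i + 1))

/-- Trapezoidal product `T(q,n,m) = ∏_{i=0}^{m-1} (q+i)_{n-2i}`. -/
noncomputable def trapT (q : ℝ) (n m : ℤ) : ℝ :=
  ∏ i ∈ Finset.range m.toNat, poch (q + i) (n - 2 * i)

/-- Skipping trapezoidal product `V(q,n,m) = ∏_{i=0}^{m-1} [q+2i]_{n-2i}`. -/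
noncomputable def trapV (q : ℝ) (n m : ℤ) : ℝ :=
  ∏ i ∈ Finset.range m.toNat, spoch (q + 2 * i) (n - 2 * i)

/-- Hyperfactorial `H(n) = 0!·1!·2!⋯(n-1)!`. -/
def hyperfac (n : ℕ) : ℕ := ∏ i ∈ Finset.range n, i !

/-- Skipping hyperfactorial `H₂(n)`:
`0!·2!·4!⋯(n-2)!` if `n` is even, `1!·3!·5!⋯(n-2)!` if `n` is odd. -/
def hyperfac2 (n : ℕ) : ℕ :=
  ∏ i ∈ Finset.range (n / 2), (if n % 2 = 0 then (2 * i)! else (2 * i + 1)!)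

/-- Partial sum `s_k(t) = t 1 + ⋯ + t k` (sequences are indexed from 1). -/
def pSum (t : ℕ → ℕ) (k : ℕ) : ℕ := ∑ i ∈ Finset.Icc 1 k, t i

/-- `E(t) = t 2 + t 4 + ⋯ + t (2l)` for a sequence of length `2l`. -/
def evenSum (l : ℕ) (t : ℕ → ℕ) : ℕ := ∑ i ∈ Finset.Icc 1 l, t (2 * i)

/-- `Q(t₁,…,t_{2l})`. -/
noncomputable def Qfun (l : ℕ) (t : ℕ → ℕ) : ℝ :=
  ((∏ i ∈ Finset.Icc 1 l, ((pSum t (2 * i))! : ℝ) / ((pSum t (2 * i - 1))! : ℝ)) /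
      (hyperfac2 (2 * evenSum l t + 1) : ℝ)) *
    (∏ i ∈ Finset.Icc 1 l,
      ((hyperfac2 (2 * pSum t (2 * i) + 1) : ℝ) * (hyperfac (2 * pSum t (2 * i - 1) + 2) : ℝ)) /
        (hyperfac2 (2 * pSum t (2 * i - 1) + 3) : ℝ)) *
    (∏ p ∈ (Finset.Icc 1 (2 * l) ×ˢ Finset.Icc 1 (2 * l)).filter
        (fun p => p.1 < p.2 ∧ (p.2 - p.1) % 2 = 1),
      (hyperfac (pSum t p.2 - pSum t p.1) : ℝ) / (hyperfac (pSum t p.2 + pSum t p.1 + 1) : ℝ)) *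
    (∏ p ∈ (Finset.Icc 1 (2 * l) ×ˢ Finset.Icc 1 (2 * l)).filter
        (fun p => p.1 < p.2 ∧ (p.2 - p.1) % 2 = 0),
      (hyperfac (pSum t p.2 + pSum t p.1 + 1) : ℝ) / (hyperfac (pSum t p.2 - pSum t p.1) : ℝ))

/-- Build an indexed-from-1 sequence from a list. -/
def seqOf (L : List ℕ) : ℕ → ℕ := fun i => L.getD (i - 1) 0

/-- `Q` on four entries. -/
noncomputable def Q4 (t1 t2 t3 t4 : ℕ) : ℝ := Qfun 2 (seqOf [t1, t2, t3, t4])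

/-- Proctor's product formula `P_{a,b,c}`. -/
noncomputable def Pf (a b c : ℕ) : ℝ :=
  ∏ i ∈ Finset.Icc 1 a,
    ((∏ j ∈ Finset.Icc 1 (b - a + 1), ((c + i + j - 1 : ℕ) : ℝ) / ((i + j - 1 : ℕ) : ℝ)) *
      ∏ j ∈ Finset.Icc (b - a + 2) (b - a + i),
        ((2 * c + i + j - 1 : ℕ) : ℝ) / ((i + j - 1 : ℕ) : ℝ))

/-- Ciucu's product formula `P′_{a,b,c}`. -/
noncomputable def Pf' (a b c : ℕ) : ℝ :=
  (2 : ℝ) ^ (-(a : ℤ)) *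
    (∏ i ∈ Finset.Icc 1 a, ((2 * c + (b - a) + i : ℕ) : ℝ) / ((c + (b - a) + i : ℕ) : ℝ)) *
    Pf a b c

/-- `φ_{x,y,z}(a,b)`. -/
noncomputable def phi (x y z a b : ℕ) : ℝ :=
  (Pf y (y + 2 * a) b * Pf (z + b) (z + b) a * Q4 a b x (y + z) /
      Pf (y + z + b) (y + z + b) a) *
    (trapT ((x : ℝ) + b + 1) ((y : ℤ) + a - 1) a *
      trapT ((x : ℝ) + z + a + b + 2) ((y : ℤ) + a - 1) a *
      trapT (2 * (a : ℝ) + b + 2) ((y : ℤ) + b - 1) b *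
      trapT ((z : ℝ) + 1) ((y : ℤ) + b - 1) b) /
    (trapT ((b : ℝ) + 1) ((y : ℤ) + a - 1) a *
      trapT ((z : ℝ) + a + b + 2) ((y : ℤ) + a - 1) a *
      trapT ((x : ℝ) + 2 * a + b + 2) ((y : ℤ) + b - 1) b *
      trapT ((x : ℝ) + z + 1) ((y : ℤ) + b - 1) b)

/-- `ψ_{x,y,z}(a,b)`. -/
noncomputable def psi (x y z a b : ℕ) : ℝ :=
  (Pf' y (y + 2 * a + 1) b * Pf (z + b) (z + b) a * Q4 a b x (y + z) /
      Pf (y + z + b) (y + z + b) a) *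
    (trapV (2 * (a : ℝ) + 2 * b + 3) ((y : ℤ) + z - 1) y /
      trapV (2 * (x : ℝ) + 2 * a + 2 * b + 3) ((y : ℤ) + z - 1) y) *
    (trapT ((x : ℝ) + b + 1) ((y : ℤ) + z + 2 * a) y *
      trapT (2 * (a : ℝ) + b + 2) ((y : ℤ) + b - 1) b *
      trapT ((z : ℝ) + 1) ((y : ℤ) + b - 1) b) /
    (trapT ((b : ℝ) + 1) ((y : ℤ) + z + 2 * a) y *
      trapT ((x : ℝ) + 2 * a + b + 2) ((y : ℤ) + b - 1) b *
      trapT ((x : ℝ) + z + 1) ((y : ℤ) + b - 1) b)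

/-- `o_i(a) = a (2i-1) + a (2i+1) + ⋯ + a (2k-1)`. -/
def oddTail (k : ℕ) (a : ℕ → ℕ) (i : ℕ) : ℕ := ∑ j ∈ Finset.Icc i k, a (2 * j - 1)

/-- `e_i(a) = a (2i) + a (2i+2) + ⋯ + a (2k)`. -/
def evenTail (k : ℕ) (a : ℕ → ℕ) (i : ℕ) : ℕ := ∑ j ∈ Finset.Icc i k, a (2 * j)

/-- The correction factor `f_{x,y,z}(a)` for a sequence `a = (a 1, …, a (2k))`. -/
noncomputable def ffun (k : ℕ) (a : ℕ → ℕ) (x y z : ℕ) : ℝ :=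
  (Qfun (k + 1) (fun i => if i = 1 then 0 else if i = 2 * k + 2 then y else a (i - 1)) *
      Qfun k (fun i => if i = 2 * k then a (2 * k) + z else a i)) /
    (Pf y (y + 2 * oddTail k a 1) (evenTail k a 1) *
      Pf (z + evenTail k a 1) (z + evenTail k a 1) (oddTail k a 1)) *
    (∏ i ∈ Finset.Icc 2 k,
      (trapT ((x : ℝ) + z + evenTail k a i + 1)
          ((a (2 * i - 2) : ℤ) + oddTail k a i - 1) (oddTail k a i) *
        trapT ((y : ℝ) + evenTail k a i + 1)
          ((a (2 * i - 2) : ℤ) + oddTail k a i - 1) (oddTail k a i)) /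
      (trapT ((x : ℝ) + y + evenTail k a i + 1)
          ((a (2 * i - 2) : ℤ) + oddTail k a i - 1) (oddTail k a i) *
        trapT ((z : ℝ) + evenTail k a i + 1)
          ((a (2 * i - 2) : ℤ) + oddTail k a i - 1) (oddTail k a i))) *
    (∏ i ∈ Finset.Icc 2 k,
      (trapT ((x : ℝ) + y + pSum a (2 * i - 1) + pSum a (2 * k) + 2)
          ((a (2 * i - 2) : ℤ) + oddTail k a i - 1) (oddTail k a i) *
        trapT ((z : ℝ) + pSum a (2 * i - 1) + pSum a (2 * k) + 2)
          ((a (2 * i - 2) : ℤ) + oddTail k a i - 1) (oddTail k a i)) /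
      (trapT ((x : ℝ) + z + pSum a (2 * i - 1) + pSum a (2 * k) + 2)
          ((a (2 * i - 2) : ℤ) + oddTail k a i - 1) (oddTail k a i) *
        trapT ((y : ℝ) + pSum a (2 * i - 1) + pSum a (2 * k) + 2)
          ((a (2 * i - 2) : ℤ) + oddTail k a i - 1) (oddTail k a i)))

/-- `Φ_{x,y,z}(a) = φ_{x,y,z}(O(a),E(a)) · f_{x,y,z}(a)`. -/
noncomputable def PhiFun (k : ℕ) (a : ℕ → ℕ) (x y z : ℕ) : ℝ :=
  phi x y z (oddTail k a 1) (evenTail k a 1) * ffun k a x y z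

lemma poch_pos (q : ℝ) (n : ℤ) (hq : 0 < q) (h : 0 < q + n) : 0 < poch q n := by
  unfold poch
  split_ifs with hn
  · exact Finset.prod_pos fun i _ => by positivity
  · apply one_div_pos.mpr
    apply Finset.prod_pos
    intro i hi
    have h1 : (i : ℤ) + 1 ≤ -n := by
      have := Finset.mem_range.mp hi
      omega
    have h2 : (i : ℝ) + 1 ≤ -(n : ℝ) := by exact_mod_cast h1
    linarith

lemma trapT_ne (q : ℝ) (n m : ℤ) (hq : 0 < q) (h : 0 < q + n - m + 1) : trapT q n m ≠ 0 := by
  unfold trapT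
  apply Finset.prod_ne_zero_iff.mpr
  intro i hi
  apply ne_of_gt
  have h1 : (i : ℤ) + 1 ≤ m := by
    have := Finset.mem_range.mp hi
    omega
  have h2 : (i : ℝ) + 1 ≤ (m : ℝ) := by exact_mod_cast h1
  apply poch_pos
  · positivity
  · push_cast
    linarith

lemma Pf_ne (a b c : ℕ) : Pf a b c ≠ 0 := by
  unfold Pf
  apply ne_of_gt
  apply Finset.prod_pos
  intro i hi
  have hi := Finset.mem_Icc.mp hi
  apply mul_pos <;> apply Finset.prod_pos <;> intro j hj <;>
    have hj := Finset.mem_Icc.mp hj <;> apply _root_.div_pos <;> apply Nat.cast_pos.mpr <;> omega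

lemma hyperfac_succ (n : ℕ) : hyperfac (n + 1) = hyperfac n * n ! := by
  simp [hyperfac, Finset.prod_range_succ]

lemma hyperfac2_succ (n : ℕ) : hyperfac2 (2 * n + 3) = hyperfac2 (2 * n + 1) * (2 * n + 1)! := by
  unfold hyperfac2
  have h1 : (2 * n + 3) / 2 = n + 1 := by omega
  have h2 : (2 * n + 1) / 2 = n := by omega
  have h3 : (2 * n + 3) % 2 = 1 := by omega
  have h4 : (2 * n + 1) % 2 = 1 := by omega
  rw [h1, h2, h3, h4, Finset.prod_range_succ]
  simp

lemma hyperfac_ne (n : ℕ) : (hyperfac n : ℝ) ≠ 0 := by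
  unfold hyperfac
  exact_mod_cast Finset.prod_ne_zero_iff.mpr fun i _ => Nat.factorial_ne_zero i

lemma hyperfac2_ne (n : ℕ) : (hyperfac2 n : ℝ) ≠ 0 := by
  unfold hyperfac2
  have : (∏ i ∈ Finset.range (n / 2), (if n % 2 = 0 then (2 * i)! else (2 * i + 1)!)) ≠ 0 := by
    apply Finset.prod_ne_zero_iff.mpr
    intro i _
    split_ifs <;> exact Nat.factorial_ne_zero _
  exact_mod_cast this

/-- Closed form of `Q(a,b,0,w)` with `n = b + w`. -/
noncomputable def Rf (a n : ℕ) : ℝ :=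
  ((a + n)! : ℝ) / (a ! : ℝ) * ((hyperfac2 (2 * (a + n) + 1) : ℝ) * hyperfac (2 * a + 2) *
    hyperfac n) / ((hyperfac2 (2 * n + 1) : ℝ) * hyperfac2 (2 * a + 3) * hyperfac (2 * a + n + 1))

lemma Q4_eq (a b w : ℕ) : Q4 a b 0 w = Rf a (b + w) := by
  have e1 : (Finset.Icc 1 (2 * 2) ×ˢ Finset.Icc 1 (2 * 2)).filter
        (fun p : ℕ × ℕ => p.1 < p.2 ∧ (p.2 - p.1) % 2 = 1) =
        {(1, 2), (2, 3), (3, 4), (1, 4)} := by decide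
  have e2 : (Finset.Icc 1 (2 * 2) ×ˢ Finset.Icc 1 (2 * 2)).filter
        (fun p : ℕ × ℕ => p.1 < p.2 ∧ (p.2 - p.1) % 2 = 0) =
        {(1, 3), (2, 4)} := by decide
  have e3 : Finset.Icc 1 2 = {1, 2} := by decide
  have p1 : pSum (seqOf [a, b, 0, w]) 1 = a := by
    simp [pSum, seqOf]
  have p2 : pSum (seqOf [a, b, 0, w]) 2 = a + b := by
    simp [pSum, seqOf, Finset.sum_Icc_succ_top]
  have p3 : pSum (seqOf [a, b, 0, w]) 3 = a + b := by
    simp [pSum, seqOf, Finset.sum_Icc_succ_top]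
  have p4 : pSum (seqOf [a, b, 0, w]) 4 = a + b + w := by
    simp [pSum, seqOf, Finset.sum_Icc_succ_top]
  have pe : evenSum 2 (seqOf [a, b, 0, w]) = b + w := by
    simp [evenSum, seqOf, Finset.sum_Icc_succ_top]
  unfold Q4 Qfun Rf
  rw [e1, e2, e3, pe]
  have q1 : ∀ f : ℕ → ℝ, ∏ i ∈ ({1, 2} : Finset ℕ), f i = f 1 * f 2 := by
    intro f; simp
  have q2 : ∀ f : ℕ × ℕ → ℝ, ∏ i ∈ ({(1, 3), (2, 4)} : Finset (ℕ × ℕ)), f i =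
      f (1, 3) * f (2, 4) := by
    intro f; simp
  have q4 : ∀ f : ℕ × ℕ → ℝ,
      ∏ i ∈ ({(1, 2), (2, 3), (3, 4), (1, 4)} : Finset (ℕ × ℕ)), f i =
      f (1, 2) * (f (2, 3) * (f (3, 4) * f (1, 4))) := by
    intro f; simp
  rw [q1, q1, q2, q4]
  norm_num only [p1, p2, p3, p4]
  have s1 : a + b - a = b := by omega
  have s2 : a + b - (a + b) = 0 := by omega
  have s3 : a + b + w - (a + b) = w := by omega
  have s4 : a + b + w - a = b + w := by omega
  have h0 : hyperfac 0 = 1 := by simp [hyperfac]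
  have t1 : hyperfac (2 * (a + b) + 2) = hyperfac (2 * (a + b) + 1) * (2 * (a + b) + 1)! :=
    hyperfac_succ _
  have t2 : a + b + (a + b) + 1 = 2 * (a + b) + 1 := by ring
  have t3 : a + b + w + a + 1 = 2 * a + (b + w) + 1 := by ring
  rw [s1, s2, s3, s4, h0, t1, t2, t3, hyperfac2_succ (a + b)]
  have n1 := fun n => hyperfac_ne n
  have n2 := fun n => hyperfac2_ne n
  have n3 : ∀ n : ℕ, ((n ! : ℕ) : ℝ) ≠ 0 := fun n => by positivity
  have g1 := n1 b
  have g2 := n1 w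
  have g3 := n1 (2 * (a + b) + 1)
  have g4 := n1 (a + b + a + 1)
  have g5 := n1 (a + b + w + (a + b) + 1)
  have g6 := n1 (2 * a + (b + w) + 1)
  have g7 := n2 (2 * (a + b) + 1)
  have g8 := n2 (2 * a + 3)
  have g9 := n2 (2 * (b + w) + 1)
  have g10 := n3 (2 * (a + b) + 1)
  have g11 := n3 (a + b)
  have g12 := n3 a
  rw [← add_assoc a b w]
  push_cast
  generalize (hyperfac b : ℝ) = x1 at *
  generalize (hyperfac w : ℝ) = x2 at *
  generalize (hyperfac (2 * (a + b) + 1) : ℝ) = x3 at *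
  generalize (hyperfac (a + b + a + 1) : ℝ) = x4 at *
  generalize (hyperfac (a + b + w + (a + b) + 1) : ℝ) = x5 at *
  generalize (hyperfac (2 * a + (b + w) + 1) : ℝ) = x6 at *
  generalize (hyperfac2 (2 * (a + b) + 1) : ℝ) = x7 at *
  generalize (hyperfac2 (2 * a + 3) : ℝ) = x8 at *
  generalize (hyperfac2 (2 * (b + w) + 1) : ℝ) = x9 at *
  generalize ((2 * (a + b) + 1)! : ℝ) = x10 at *
  generalize ((a + b)! : ℝ) = x11 at *
  generalize (a ! : ℝ) = x12 at *
  field_simp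

lemma prod_fac (c : ℕ) : ∀ m : ℕ, (∏ j ∈ Finset.Icc 2 (m + 1), ((c + j : ℕ) : ℝ)) * (c + 1)! =
    (c + m + 1)! := by
  intro m
  induction m with
  | zero => simp
  | succ m ih =>
    rw [Finset.prod_Icc_succ_top (by omega), mul_right_comm, ih]
    rw [show c + (m + 1) + 1 = (c + m + 1) + 1 by ring, Nat.factorial_succ (c + m + 1)]
    push_cast
    ring

lemma Rf_eq (a n : ℕ) : Rf a n = Pf n n a := by
  induction n with
  | zero =>
    have t1 : hyperfac (2 * a + 2) = hyperfac (2 * a + 1) * (2 * a + 1)! := hyperfac_succ _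
    have t2 : hyperfac2 (2 * 0 + 1) = 1 := by simp [hyperfac2]
    have t3 : hyperfac 0 = 1 := by simp [hyperfac]
    have n3 : ∀ n : ℕ, ((n ! : ℕ) : ℝ) ≠ 0 := fun n => by positivity
    have g1 := hyperfac_ne (2 * a + 1)
    have g2 := hyperfac2_ne (2 * a + 1)
    have g3 := n3 (2 * a + 1)
    have g4 := n3 a
    simp only [Rf, Pf, add_zero, t1, t2, t3, hyperfac2_succ a]
    push_cast
    simp
    field_simp
  | succ n ih =>
    have hP : Pf (n + 1) (n + 1) a = Pf n n a * (((a + n + 1 : ℕ) : ℝ) / ((n + 1 : ℕ) : ℝ) *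
        ((∏ j ∈ Finset.Icc 2 (n + 1), ((2 * a + n + j : ℕ) : ℝ)) /
          ∏ j ∈ Finset.Icc 2 (n + 1), ((n + j : ℕ) : ℝ))) := by
      unfold Pf
      rw [Finset.prod_Icc_succ_top (by omega)]
      simp only [Nat.sub_self, zero_add]
      congr 1
      rw [← Finset.prod_div_distrib]
      congr 1
      · rw [Finset.Icc_self, Finset.prod_singleton,
          show a + (n + 1) + 1 - 1 = a + n + 1 by omega, show n + 1 + 1 - 1 = n + 1 by omega]
      · apply Finset.prod_congr rfl
        intro j hj
        rw [show 2 * a + (n + 1) + j - 1 = 2 * a + n + j by omega,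
          show n + 1 + j - 1 = n + j by omega]
    have k1 := prod_fac (2 * a + n) n
    have k2 := prod_fac n n
    have n3 : ∀ n : ℕ, ((n ! : ℕ) : ℝ) ≠ 0 := fun n => by positivity
    have k1' := eq_div_of_mul_eq (n3 _) k1
    have k2' := eq_div_of_mul_eq (n3 _) k2
    rw [hP, ← ih, k1', k2']
    unfold Rf
    have r1 : hyperfac2 (2 * (a + (n + 1)) + 1) =
        hyperfac2 (2 * (a + n) + 1) * (2 * a + n + n + 1)! := by
      rw [show 2 * a + n + n + 1 = 2 * (a + n) + 1 by ring]
      exact hyperfac2_succ _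
    have r2 : hyperfac2 (2 * (n + 1) + 1) = hyperfac2 (2 * n + 1) * (n + n + 1)! := by
      rw [show n + n + 1 = 2 * n + 1 by ring]
      exact hyperfac2_succ _
    have r3 : hyperfac (2 * a + (n + 1) + 1) = hyperfac (2 * a + n + 1) * (2 * a + n + 1)! :=
      hyperfac_succ _
    rw [r1, r2, r3, hyperfac_succ n, ← add_assoc a n 1, Nat.factorial_succ (a + n),
      Nat.factorial_succ n]
    have g1 := hyperfac_ne (2 * a + n + 1)
    have g2 := hyperfac2_ne (2 * n + 1)
    have g3 := hyperfac2_ne (2 * a + 3)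
    have g4 := n3 (2 * a + n + 1)
    have g5 := n3 (n + n + 1)
    have g6 := n3 a
    have g7 := n3 n
    have g9 := n3 (2 * a + n + n + 1)
    have g8 : (n : ℝ) + 1 ≠ 0 := by positivity
    push_cast
    field_simp

/-- factorization of `Φ` at `x = 0`. -/
theorem claim_Phi_x_zero (k : ℕ) (hk : 2 ≤ k) (a : ℕ → ℕ)
    (ha : ∀ i ∈ Finset.Icc 1 (2 * k), 1 ≤ a i) (y z : ℕ) :
    PhiFun k a 0 y z =
      Qfun (k + 1) (fun i => if i = 1 then 0 else if i = 2 * k + 2 then y else a (i - 1)) *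
        Qfun k (fun i => if i = 2 * k then a (2 * k) + z else a i) := by
  have cancel4 : ∀ A B C D : ℝ, A ≠ 0 → B ≠ 0 → C ≠ 0 → D ≠ 0 →
      ∀ X : ℝ, X * (A * B * C * D) / (A * B * C * D) = X := by
    intro A B C D hA hB hC hD X
    field_simp
  have hf1 : ∀ i, trapT ((y : ℝ) + evenTail k a i + 1)
          ((a (2 * i - 2) : ℤ) + oddTail k a i - 1) (oddTail k a i) ≠ 0 := fun i => by
    apply trapT_ne
    · positivity
    · push_cast; ring_nf; positivity
  have hf2 : ∀ i, trapT ((z : ℝ) + evenTail k a i + 1)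
          ((a (2 * i - 2) : ℤ) + oddTail k a i - 1) (oddTail k a i) ≠ 0 := fun i => by
    apply trapT_ne
    · positivity
    · push_cast; ring_nf; positivity
  have hf3 : ∀ i, trapT ((y : ℝ) + pSum a (2 * i - 1) + pSum a (2 * k) + 2)
          ((a (2 * i - 2) : ℤ) + oddTail k a i - 1) (oddTail k a i) ≠ 0 := fun i => by
    apply trapT_ne
    · positivity
    · push_cast; ring_nf; positivity
  have hf4 : ∀ i, trapT ((z : ℝ) + pSum a (2 * i - 1) + pSum a (2 * k) + 2)
          ((a (2 * i - 2) : ℤ) + oddTail k a i - 1) (oddTail k a i) ≠ 0 := fun i => by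
    apply trapT_ne
    · positivity
    · push_cast; ring_nf; positivity
  have hphi : ∀ A B : ℕ, phi 0 y z A B = Pf y (y + 2 * A) B * Pf (z + B) (z + B) A := by
    intro A B
    unfold phi
    rw [Q4_eq, Rf_eq, show B + (y + z) = y + z + B by ring]
    simp only [Nat.cast_zero, zero_add]
    rw [cancel4, mul_div_assoc, div_self (Pf_ne _ _ _), mul_one]
    all_goals
      apply trapT_ne
      · positivity
      · push_cast; ring_nf; positivity
  unfold PhiFun ffun
  rw [hphi]
  simp only [Nat.cast_zero, zero_add]
  rw [Finset.prod_eq_one, Finset.prod_eq_one, mul_one, mul_one,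
    mul_div_cancel₀ _ (mul_ne_zero (Pf_ne _ _ _) (Pf_ne _ _ _))]
  · intro i _
    rw [mul_comm]
    exact div_self (mul_ne_zero (hf4 i) (hf3 i))
  · intro i _
    rw [mul_comm]
    exact div_self (mul_ne_zero (hf1 i) (hf2 i))
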